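/- For X ∈ S₂(H) define τ_X : S₂(H) → S₂(H) by τ_X(Y) = ∑_{n=0}^∞ (1/(2n+1)!) · (ad X / 2)^{2n}(Y), i.e. τ_X = sinh(ad X/2)/(ad X/2). Then τ_X is a bounded bijective linear operator on S₂(H) satisfying ‖τ_X(Y)‖₂ ≥ ‖Y‖₂ for every Y ∈ S₂(H) (so that τ_X⁻¹ exists and has operator norm at most 1), and for X ≠ 0 its operator norm is at most sinh(2‖X‖₂)/‖X‖₂. -/

import Mathlib

noncomputable section

open scoped InnerProductSpace

variable {H : Type*} [NormedAddCommGroup H] [InnerProductSpace ℂ H] [CompleteSpace H]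
variable {ι : Type*}

/-- `A` is a Hilbert–Schmidt operator (w.r.t. the Hilbert basis `e`). -/
def IsHS (e : HilbertBasis ι ℂ H) (A : H →L[ℂ] H) : Prop :=
  Summable fun i => ‖A (e i)‖ ^ 2

/-- The Hilbert–Schmidt norm of `A` (w.r.t. the Hilbert basis `e`). -/
def hsNorm (e : HilbertBasis ι ℂ H) (A : H →L[ℂ] H) : ℝ :=
  Real.sqrt (∑' i, ‖A (e i)‖ ^ 2)

/-- The real Hilbert–Schmidt inner product `⟨A, B⟩₂ = ∑ ⟪A eᵢ, B eᵢ⟫`. -/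
def hsInner (e : HilbertBasis ι ℂ H) (A B : H →L[ℂ] H) : ℝ :=
  (∑' i, (inner ℂ (A (e i)) (B (e i)) : ℂ)).re

/-- The trace of an operator, `Tr T = ∑ ⟪eᵢ, T eᵢ⟫`. -/
def opTrace (e : HilbertBasis ι ℂ H) (T : H →L[ℂ] H) : ℂ :=
  ∑' i, (inner ℂ (e i) (T (e i)) : ℂ)

/-- `T` is trace class: it is the product of two Hilbert–Schmidt operators. -/
def IsTraceClass (e : HilbertBasis ι ℂ H) (T : H →L[ℂ] H) : Prop :=
  ∃ B C : H →L[ℂ] H, IsHS e B ∧ IsHS e C ∧ T = B * C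

/-- `A ∈ S₂(H)`: self-adjoint and Hilbert–Schmidt. -/
def MemS2 (e : HilbertBasis ι ℂ H) (A : H →L[ℂ] H) : Prop :=
  IsSelfAdjoint A ∧ IsHS e A

/-- `p ∈ P`: self-adjoint, positive definite (invertible and `⟪p x, x⟫ ≥ 0`),
with `p - 1` Hilbert–Schmidt. -/
def MemP (e : HilbertBasis ι ℂ H) (p : H →L[ℂ] H) : Prop :=
  IsSelfAdjoint p ∧ IsUnit p ∧ (∀ x : H, 0 ≤ (inner ℂ (p x) x : ℂ).re) ∧ IsHS e (p - 1)

/-- `x ∈ GL₂(H)`: invertible with `x - 1` Hilbert–Schmidt. -/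
def MemGL2 (e : HilbertBasis ι ℂ H) (x : H →L[ℂ] H) : Prop :=
  IsUnit x ∧ IsHS e (x - 1)

/-- `x ∈ U₂(H)`: unitary with `x - 1` Hilbert–Schmidt. -/
def MemU2 (e : HilbertBasis ι ℂ H) (x : H →L[ℂ] H) : Prop :=
  x ∈ unitary (H →L[ℂ] H) ∧ IsHS e (x - 1)

/-- `p^{1/2}`, via continuous functional calculus. -/
def psqrt (p : H →L[ℂ] H) : H →L[ℂ] H := cfc Real.sqrt p

/-- `p^{-1/2}`, via continuous functional calculus. -/
def pinvsqrt (p : H →L[ℂ] H) : H →L[ℂ] H := cfc (fun t : ℝ => (Real.sqrt t)⁻¹) p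

/-- `log p`, via continuous functional calculus. -/
def plog (p : H →L[ℂ] H) : H →L[ℂ] H := cfc Real.log p

/-- The geodesic distance `d(p, q) = ‖log (p^{-1/2} q p^{-1/2})‖₂`. -/
def gdist (e : HilbertBasis ι ℂ H) (p q : H →L[ℂ] H) : ℝ :=
  hsNorm e (plog (pinvsqrt p * q * pinvsqrt p))

/-- The commutator `[A, B] = AB - BA`. -/
def brk (A B : H →L[ℂ] H) : H →L[ℂ] H := A * B - B * A

/-- The constant-speed geodesic `t ↦ p^{1/2} exp(t K) p^{1/2}`. -/
def geoCurve (p K : H →L[ℂ] H) (t : ℝ) : H →L[ℂ] H :=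
  psqrt p * NormedSpace.exp (t • K) * psqrt p

/-- The geodesic from `p` to `q`:
`t ↦ p^{1/2} exp(t log(p^{-1/2} q p^{-1/2})) p^{1/2}`. -/
def geodesic (p q : H →L[ℂ] H) (t : ℝ) : H →L[ℂ] H :=
  geoCurve p (plog (pinvsqrt p * q * pinvsqrt p)) t

/-- The image `exp E` of a set of operators under the exponential map. -/
def expSet (E : Set (H →L[ℂ] H)) : Set (H →L[ℂ] H) := NormedSpace.exp '' E

/-- The orthogonal complement of `E` inside `S₂(H)` for the Hilbert–Schmidt
inner product. -/
def hsPerp (e : HilbertBasis ι ℂ H) (E : Set (H →L[ℂ] H)) : Set (H →L[ℂ] H) :=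
  {Y | MemS2 e Y ∧ ∀ X ∈ E, hsInner e X Y = 0}

/-- `E` is closed in `S₂(H)` with respect to the Hilbert–Schmidt norm. -/
def IsHSClosed (e : HilbertBasis ι ℂ H) (E : Set (H →L[ℂ] H)) : Prop :=
  ∀ X : H →L[ℂ] H, MemS2 e X → (∀ ε > (0:ℝ), ∃ Y ∈ E, hsNorm e (X - Y) < ε) → X ∈ E

/-- The operator `τ_X = sinh(ad X / 2) / (ad X / 2)
  = ∑ (1/(2n+1)!) (ad X / 2)^{2n}` acting on operators. -/
def tauOp (X : H →L[ℂ] H) : (H →L[ℂ] H) →L[ℂ] (H →L[ℂ] H) :=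
  ∑' n : ℕ, ((Nat.factorial (2 * n + 1) : ℝ))⁻¹ •
    (((2 : ℂ)⁻¹) • (ContinuousLinearMap.mul ℂ (H →L[ℂ] H) X -
      (ContinuousLinearMap.mul ℂ (H →L[ℂ] H)).flip X)) ^ (2 * n)

set_option linter.unusedSectionVars false

theorem ax_lp_norm_sq {E : Type*} [NormedAddCommGroup E] (f : lp (fun _ : ι => E) 2) :
    HasSum (fun i => ‖f i‖ ^ 2) (‖f‖ ^ 2) := by
  have := lp.hasSum_norm (p := 2) (by norm_num) f
  simpa using this

theorem ax_lp_mem {E : Type*} [NormedAddCommGroup E] {f : ι → E}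
    (h : Summable fun i => ‖f i‖ ^ 2) : Memℓp f 2 := by
  apply memℓp_gen
  simpa using h

theorem ax_parseval (e : HilbertBasis ι ℂ H) (x : H) :
    HasSum (fun i => ‖(inner ℂ (e i) x : ℂ)‖ ^ 2) (‖x‖ ^ 2) := by
  have := ax_lp_norm_sq (e.repr x)
  simpa [HilbertBasis.repr_apply_apply] using this

theorem ax_ext (e : HilbertBasis ι ℂ H) {x y : H}
    (h : ∀ i, (inner ℂ (e i) x : ℂ) = inner ℂ (e i) y) : x = y := by
  apply e.repr.injective
  ext i
  simpa [HilbertBasis.repr_apply_apply] using h i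

theorem ax_op_ext (e : HilbertBasis ι ℂ H) {A B : H →L[ℂ] H}
    (h : ∀ i, A (e i) = B (e i)) : A = B := by
  have : ContinuousLinearMap.adjoint A = ContinuousLinearMap.adjoint B := by
    ext y
    apply ax_ext e
    intro i
    rw [ContinuousLinearMap.adjoint_inner_right, ContinuousLinearMap.adjoint_inner_right, h]
  simpa using congrArg ContinuousLinearMap.adjoint this

/-- Squared Hilbert–Schmidt norm in extended nonnegative reals. -/
def axE (e : HilbertBasis ι ℂ H) (A : H →L[ℂ] H) : ENNReal :=
  ∑' i, ENNReal.ofReal (‖A (e i)‖ ^ 2)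

theorem axE_of_hasSum (e : HilbertBasis ι ℂ H) (A : H →L[ℂ] H) (h : IsHS e A) :
    axE e A = ENNReal.ofReal (hsNorm e A ^ 2) := by
  unfold axE hsNorm
  rw [Real.sq_sqrt (tsum_nonneg fun _ => by positivity),
    ENNReal.ofReal_tsum_of_nonneg (fun _ => by positivity) h]

theorem axE_isHS (e : HilbertBasis ι ℂ H) (A : H →L[ℂ] H) (h : axE e A ≠ ⊤) : IsHS e A := by
  unfold axE at h
  have := ENNReal.summable_toReal h
  unfold IsHS
  refine this.congr fun i => ?_
  rw [ENNReal.toReal_ofReal (by positivity)]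

theorem axE_parseval (e : HilbertBasis ι ℂ H) (x : H) :
    ENNReal.ofReal (‖x‖ ^ 2) = ∑' j, ENNReal.ofReal (‖(inner ℂ (e j) x : ℂ)‖ ^ 2) := by
  rw [← (ax_parseval e x).tsum_eq,
    ENNReal.ofReal_tsum_of_nonneg (fun _ => by positivity) (ax_parseval e x).summable]

theorem axE_star (e : HilbertBasis ι ℂ H) (A : H →L[ℂ] H) : axE e (star A) = axE e A := by
  unfold axE
  simp_rw [axE_parseval e]
  rw [ENNReal.tsum_comm]
  congr! 6 with i j
  rw [ContinuousLinearMap.star_eq_adjoint, ContinuousLinearMap.adjoint_inner_right, norm_inner_symm]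

theorem hs_star (e : HilbertBasis ι ℂ H) {A : H →L[ℂ] H} (h : IsHS e A) : IsHS e (star A) := by
  apply axE_isHS
  rw [axE_star, axE_of_hasSum e A h]
  exact ENNReal.ofReal_ne_top

theorem hsNorm_nonneg' (e : HilbertBasis ι ℂ H) (A : H →L[ℂ] H) : 0 ≤ hsNorm e A :=
  Real.sqrt_nonneg _

theorem hsNorm_star (e : HilbertBasis ι ℂ H) {A : H →L[ℂ] H} (h : IsHS e A) :
    hsNorm e (star A) = hsNorm e A := by
  have := axE_star e A
  rw [axE_of_hasSum e A h, axE_of_hasSum e _ (hs_star e h),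
    ENNReal.ofReal_eq_ofReal_iff (by positivity) (by positivity)] at this
  exact (sq_eq_sq₀ (hsNorm_nonneg' _ _) (hsNorm_nonneg' _ _)).1 this

/-- Hilbert–Schmidt operators as vectors of `ℓ²(ι, H)`. -/
def toK (e : HilbertBasis ι ℂ H) (A : H →L[ℂ] H) (h : IsHS e A) : lp (fun _ : ι => H) 2 :=
  ⟨fun i => A (e i), ax_lp_mem h⟩

theorem toK_apply (e : HilbertBasis ι ℂ H) (A : H →L[ℂ] H) (h : IsHS e A) (i : ι) :
    toK e A h i = A (e i) := rfl

theorem toK_norm (e : HilbertBasis ι ℂ H) (A : H →L[ℂ] H) (h : IsHS e A) :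
    ‖toK e A h‖ = hsNorm e A := by
  have := (ax_lp_norm_sq (toK e A h)).tsum_eq
  simp only [toK_apply] at this
  unfold hsNorm
  rw [this, Real.sqrt_sq (norm_nonneg _)]

theorem hs_mul_left (e : HilbertBasis ι ℂ H) (X : H →L[ℂ] H) {A : H →L[ℂ] H} (h : IsHS e A) :
    IsHS e (X * A) ∧ hsNorm e (X * A) ≤ ‖X‖ * hsNorm e A := by
  have hb : ∀ i, ‖(X * A) (e i)‖ ^ 2 ≤ ‖X‖ ^ 2 * ‖A (e i)‖ ^ 2 := fun i => by
    rw [← mul_pow]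
    gcongr
    exact X.le_opNorm _
  have hs : IsHS e (X * A) :=
    Summable.of_nonneg_of_le (fun _ => by positivity) hb (h.mul_left _)
  refine ⟨hs, ?_⟩
  unfold hsNorm
  rw [Real.sqrt_le_iff]
  refine ⟨by positivity, ?_⟩
  rw [mul_pow, Real.sq_sqrt (tsum_nonneg fun _ => by positivity), ← tsum_mul_left]
  exact hs.tsum_le_tsum hb (h.mul_left _)

theorem hs_mul_right (e : HilbertBasis ι ℂ H) (X : H →L[ℂ] H) {A : H →L[ℂ] H} (h : IsHS e A) :
    IsHS e (A * X) ∧ hsNorm e (A * X) ≤ ‖X‖ * hsNorm e A := by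
  obtain ⟨h1, h2⟩ := hs_mul_left e (star X) (hs_star e h)
  have h3 := hs_star e h1
  have h4 := hsNorm_star e h1
  rw [star_mul, star_star, star_star] at h3 h4
  rw [hsNorm_star e h, norm_star, ← h4] at h2
  exact ⟨h3, h2⟩

/-- Auxiliary operator: adjoint of the operator attached to `f`. -/
def axB (e : HilbertBasis ι ℂ H) (f : lp (fun _ : ι => H) 2) : H →L[ℂ] H :=
  LinearMap.mkContinuous
    { toFun := fun y => e.repr.symm ⟨fun i => (inner ℂ (f i) y : ℂ), ax_lp_mem
        (Summable.of_nonneg_of_le (fun _ => by positivity)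
          (fun i => by
            rw [← mul_pow]
            gcongr
            exact norm_inner_le_norm (f i) y)
          ((ax_lp_norm_sq f).summable.mul_right (‖y‖ ^ 2)))⟩
      map_add' := fun x y => by
        rw [← map_add]
        congr 1
        ext i
        exact inner_add_right _ _ _
      map_smul' := fun c y => by
        rw [RingHom.id_apply, ← map_smul]
        congr 1
        ext i
        exact inner_smul_right _ _ _ }
    ‖f‖ (fun y => by
      simp only [LinearMap.coe_mk, AddHom.coe_mk, LinearIsometryEquiv.norm_map]
      apply le_of_sq_le_sq _ (by positivity)
      rw [mul_pow]
      refine hasSum_le (fun i => ?_) (ax_lp_norm_sq _) ((ax_lp_norm_sq f).mul_right (‖y‖ ^ 2))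
      rw [← mul_pow]
      gcongr
      exact norm_inner_le_norm (f i) y)

theorem axB_norm (e : HilbertBasis ι ℂ H) (f : lp (fun _ : ι => H) 2) : ‖axB e f‖ ≤ ‖f‖ :=
  LinearMap.mkContinuous_norm_le _ (norm_nonneg _) _

theorem axB_inner (e : HilbertBasis ι ℂ H) (f : lp (fun _ : ι => H) 2) (y : H) (i : ι) :
    (inner ℂ (e i) (axB e f y) : ℂ) = inner ℂ (f i) y := by
  rw [← HilbertBasis.repr_apply_apply]
  simp [axB]

theorem axB_adj (e : HilbertBasis ι ℂ H) (f : lp (fun _ : ι => H) 2) (i : ι) :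
    star (axB e f) (e i) = f i := by
  apply ext_inner_right ℂ
  intro y
  rw [ContinuousLinearMap.star_eq_adjoint, ContinuousLinearMap.adjoint_inner_left, axB_inner]

/-- The operator attached to a vector of `ℓ²(ι, H)`. -/
def axPhi (e : HilbertBasis ι ℂ H) : lp (fun _ : ι => H) 2 →L[ℂ] (H →L[ℂ] H) :=
  LinearMap.mkContinuous
    { toFun := fun f => star (axB e f)
      map_add' := fun f g => by
        apply ax_op_ext e
        intro i
        simp only [add_apply, axB_adj]
        simp
      map_smul' := fun c g => by
        apply ax_op_ext e
        intro i
        simp only [smul_apply, axB_adj]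
        simp [axB_adj] } 1
    (fun f => by
      simp only [LinearMap.coe_mk, AddHom.coe_mk, norm_star, one_mul]
      exact axB_norm e f)

theorem axPhi_apply (e : HilbertBasis ι ℂ H) (f : lp (fun _ : ι => H) 2) (i : ι) :
    axPhi e f (e i) = f i := axB_adj e f i

theorem axPhi_norm (e : HilbertBasis ι ℂ H) (f : lp (fun _ : ι => H) 2) :
    ‖axPhi e f‖ ≤ ‖f‖ := by
  change ‖star (axB e f)‖ ≤ ‖f‖
  rw [norm_star]
  exact axB_norm e f

theorem axPhi_hs (e : HilbertBasis ι ℂ H) (f : lp (fun _ : ι => H) 2) : IsHS e (axPhi e f) := by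
  unfold IsHS
  simp only [axPhi_apply]
  exact (ax_lp_norm_sq f).summable

theorem axPhi_toK (e : HilbertBasis ι ℂ H) (A : H →L[ℂ] H) (h : IsHS e A) :
    axPhi e (toK e A h) = A := ax_op_ext e fun i => by rw [axPhi_apply, toK_apply]

theorem toK_axPhi (e : HilbertBasis ι ℂ H) (f : lp (fun _ : ι => H) 2) :
    toK e (axPhi e f) (axPhi_hs e f) = f := by
  ext i
  rw [toK_apply, axPhi_apply]

theorem axPhi_hsNorm (e : HilbertBasis ι ℂ H) (f : lp (fun _ : ι => H) 2) :
    hsNorm e (axPhi e f) = ‖f‖ := by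
  rw [← toK_norm e _ (axPhi_hs e f), toK_axPhi]

theorem axPhi_inj (e : HilbertBasis ι ℂ H) : Function.Injective (axPhi e) := fun f g h => by
  ext i
  rw [← axPhi_apply e f, ← axPhi_apply e g, h]

theorem opNorm_le_hs (e : HilbertBasis ι ℂ H) (A : H →L[ℂ] H) (h : IsHS e A) :
    ‖A‖ ≤ hsNorm e A := by
  have := axPhi_norm e (toK e A h)
  rwa [axPhi_toK, toK_norm] at this

/-- Lift to `ℓ²(ι, H)` of a linear map preserving Hilbert–Schmidt operators. -/
def axLift (e : HilbertBasis ι ℂ H) (D : (H →L[ℂ] H) →L[ℂ] (H →L[ℂ] H)) (C : ℝ)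
    (h : ∀ A, IsHS e A → IsHS e (D A) ∧ hsNorm e (D A) ≤ C * hsNorm e A) :
    lp (fun _ : ι => H) 2 →L[ℂ] lp (fun _ : ι => H) 2 :=
  LinearMap.mkContinuous
    { toFun := fun f => toK e (D (axPhi e f)) (h _ (axPhi_hs e f)).1
      map_add' := fun f g => by
        apply axPhi_inj e
        simp [axPhi_toK]
      map_smul' := fun c g => by
        apply axPhi_inj e
        simp [axPhi_toK] } C
    (fun f => by
      simp only [LinearMap.coe_mk, AddHom.coe_mk, toK_norm]
      have := (h _ (axPhi_hs e f)).2
      rwa [axPhi_hsNorm] at this)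

theorem axPhi_lift (e : HilbertBasis ι ℂ H) (D : (H →L[ℂ] H) →L[ℂ] (H →L[ℂ] H)) (C : ℝ)
    (h : ∀ A, IsHS e A → IsHS e (D A) ∧ hsNorm e (D A) ≤ C * hsNorm e A)
    (f : lp (fun _ : ι => H) 2) : axPhi e (axLift e D C h f) = D (axPhi e f) :=
  axPhi_toK e _ (h _ (axPhi_hs e f)).1

theorem ax_mul_apply {E : Type*} [NormedAddCommGroup E] [NormedSpace ℂ E] (A B : E →L[ℂ] E) (x : E) :
    (A * B) x = A (B x) := rfl

/-- Left multiplication on `ℓ²(ι, H)`. -/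
def axL (e : HilbertBasis ι ℂ H) (X : H →L[ℂ] H) :
    lp (fun _ : ι => H) 2 →L[ℂ] lp (fun _ : ι => H) 2 :=
  axLift e (ContinuousLinearMap.mul ℂ (H →L[ℂ] H) X) ‖X‖ (fun _ hA => hs_mul_left e X hA)

/-- Right multiplication on `ℓ²(ι, H)`. -/
def axR (e : HilbertBasis ι ℂ H) (X : H →L[ℂ] H) :
    lp (fun _ : ι => H) 2 →L[ℂ] lp (fun _ : ι => H) 2 :=
  axLift e ((ContinuousLinearMap.mul ℂ (H →L[ℂ] H)).flip X) ‖X‖ (fun _ hA => hs_mul_right e X hA)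

theorem axPhi_L (e : HilbertBasis ι ℂ H) (X : H →L[ℂ] H) (f : lp (fun _ : ι => H) 2) :
    axPhi e (axL e X f) = X * axPhi e f := axPhi_lift e _ _ _ f

theorem axPhi_R (e : HilbertBasis ι ℂ H) (X : H →L[ℂ] H) (f : lp (fun _ : ι => H) 2) :
    axPhi e (axR e X f) = axPhi e f * X := axPhi_lift e _ _ _ f

theorem axL_norm (e : HilbertBasis ι ℂ H) (X : H →L[ℂ] H) : ‖axL e X‖ ≤ ‖X‖ := by
  unfold axL axLift
  exact LinearMap.mkContinuous_norm_le _ (norm_nonneg _) _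

theorem axR_norm (e : HilbertBasis ι ℂ H) (X : H →L[ℂ] H) : ‖axR e X‖ ≤ ‖X‖ := by
  unfold axR axLift
  exact LinearMap.mkContinuous_norm_le _ (norm_nonneg _) _

theorem axL_symm (e : HilbertBasis ι ℂ H) (X : H →L[ℂ] H) (hX : IsSelfAdjoint X)
    (f g : lp (fun _ : ι => H) 2) :
    (inner ℂ (axL e X f) g : ℂ) = inner ℂ f (axL e X g) := by
  rw [lp.inner_eq_tsum, lp.inner_eq_tsum]
  congr 1
  ext i
  have hs := (ContinuousLinearMap.isSelfAdjoint_iff_isSymmetric.1 hX)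
  rw [← axPhi_apply e (axL e X f), ← axPhi_apply e (axL e X g), axPhi_L, axPhi_L,
    ax_mul_apply, ax_mul_apply, axPhi_apply, axPhi_apply]
  exact hs _ _

/-- The adjoint on `ℓ²(ι, H)`. -/
def axJ (e : HilbertBasis ι ℂ H) (f : lp (fun _ : ι => H) 2) : lp (fun _ : ι => H) 2 :=
  toK e (star (axPhi e f)) (hs_star e (axPhi_hs e f))

theorem axPhi_J (e : HilbertBasis ι ℂ H) (f : lp (fun _ : ι => H) 2) :
    axPhi e (axJ e f) = star (axPhi e f) := axPhi_toK e _ _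

theorem axJ_norm (e : HilbertBasis ι ℂ H) (f : lp (fun _ : ι => H) 2) : ‖axJ e f‖ = ‖f‖ := by
  rw [← axPhi_hsNorm e (axJ e f), axPhi_J, hsNorm_star e (axPhi_hs e f), axPhi_hsNorm]

theorem axJ_add (e : HilbertBasis ι ℂ H) (f g : lp (fun _ : ι => H) 2) :
    axJ e (f + g) = axJ e f + axJ e g := by
  apply axPhi_inj e
  simp [axPhi_J]

theorem axJ_sub (e : HilbertBasis ι ℂ H) (f g : lp (fun _ : ι => H) 2) :
    axJ e (f - g) = axJ e f - axJ e g := by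
  apply axPhi_inj e
  simp [axPhi_J]

theorem axJ_inner (e : HilbertBasis ι ℂ H) (f g : lp (fun _ : ι => H) 2) :
    RCLike.re (inner ℂ (axJ e f) (axJ e g) : ℂ) = RCLike.re (inner ℂ f g : ℂ) := by
  rw [re_inner_eq_norm_add_mul_self_sub_norm_sub_mul_self_div_four,
    re_inner_eq_norm_add_mul_self_sub_norm_sub_mul_self_div_four,
    ← axJ_add, ← axJ_sub, axJ_norm, axJ_norm]

theorem axJ_R (e : HilbertBasis ι ℂ H) (X : H →L[ℂ] H) (hX : IsSelfAdjoint X)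
    (f : lp (fun _ : ι => H) 2) : axJ e (axR e X f) = axL e X (axJ e f) := by
  apply axPhi_inj e
  rw [axPhi_J, axPhi_R, axPhi_L, axPhi_J, star_mul, hX.star_eq]

theorem axR_symm_re (e : HilbertBasis ι ℂ H) (X : H →L[ℂ] H) (hX : IsSelfAdjoint X)
    (f g : lp (fun _ : ι => H) 2) :
    RCLike.re (inner ℂ (axR e X f) g : ℂ) = RCLike.re (inner ℂ f (axR e X g) : ℂ) := by
  rw [← axJ_inner e, axJ_R e X hX, axL_symm e X hX, ← axJ_R e X hX, axJ_inner]

theorem axR_symm (e : HilbertBasis ι ℂ H) (X : H →L[ℂ] H) (hX : IsSelfAdjoint X)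
    (f g : lp (fun _ : ι => H) 2) :
    (inner ℂ (axR e X f) g : ℂ) = inner ℂ f (axR e X g) := by
  apply Complex.ext
  · exact axR_symm_re e X hX f g
  · have := axR_symm_re e X hX f (Complex.I • g)
    rw [map_smul, inner_smul_right, inner_smul_right] at this
    simpa using this

/-- Half of the commutator with `X`, on `ℓ²(ι, H)`. -/
def axT (e : HilbertBasis ι ℂ H) (X : H →L[ℂ] H) :
    lp (fun _ : ι => H) 2 →L[ℂ] lp (fun _ : ι => H) 2 :=
  ((2 : ℂ)⁻¹) • (axL e X - axR e X)

/-- Half of the commutator with `X`, on operators. -/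
def axD (X : H →L[ℂ] H) : (H →L[ℂ] H) →L[ℂ] (H →L[ℂ] H) :=
  ((2 : ℂ)⁻¹) • (ContinuousLinearMap.mul ℂ (H →L[ℂ] H) X -
      (ContinuousLinearMap.mul ℂ (H →L[ℂ] H)).flip X)

theorem axD_apply (X Y : H →L[ℂ] H) : axD X Y = (2 : ℂ)⁻¹ • (X * Y - Y * X) := rfl

theorem axPhi_T (e : HilbertBasis ι ℂ H) (X : H →L[ℂ] H) (f : lp (fun _ : ι => H) 2) :
    axPhi e (axT e X f) = axD X (axPhi e f) := by
  rw [axD_apply, axT, smul_apply, sub_apply, map_smul, map_sub, axPhi_L, axPhi_R]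

theorem axPhi_T_pow (e : HilbertBasis ι ℂ H) (X : H →L[ℂ] H) (n : ℕ)
    (f : lp (fun _ : ι => H) 2) :
    axPhi e ((axT e X ^ n) f) = (axD X ^ n) (axPhi e f) := by
  induction n generalizing f with
  | zero => rfl
  | succ n ih =>
    rw [pow_succ, pow_succ, ax_mul_apply, ax_mul_apply, ih, axPhi_T]

theorem axT_norm (e : HilbertBasis ι ℂ H) (X : H →L[ℂ] H) : ‖axT e X‖ ≤ ‖X‖ := by
  unfold axT
  rw [norm_smul]
  have h1 := norm_sub_le (axL e X) (axR e X)
  have h2 := axL_norm e X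
  have h3 := axR_norm e X
  have : ‖(2 : ℂ)⁻¹‖ = 1 / 2 := by norm_num
  rw [this]
  linarith

theorem axT_sa (e : HilbertBasis ι ℂ H) (X : H →L[ℂ] H) (hX : IsSelfAdjoint X) :
    IsSelfAdjoint (axT e X) := by
  rw [ContinuousLinearMap.isSelfAdjoint_iff_isSymmetric]
  intro f g
  change (inner ℂ ((2 : ℂ)⁻¹ • (axL e X f - axR e X f)) g : ℂ) =
    inner ℂ f ((2 : ℂ)⁻¹ • (axL e X g - axR e X g))
  rw [inner_smul_left, inner_smul_right, inner_sub_left, inner_sub_right, axL_symm e X hX,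
    axR_symm e X hX, map_inv₀, Complex.conj_ofNat]

section series

variable {E : Type*} [NormedAddCommGroup E] [NormedSpace ℂ E]

theorem ax_pow_norm (T : E →L[ℂ] E) (n : ℕ) : ‖T ^ n‖ ≤ ‖T‖ ^ n := by
  induction n with
  | zero =>
    rw [pow_zero, pow_zero]
    exact ContinuousLinearMap.norm_id_le
  | succ n ih =>
    rw [pow_succ, pow_succ]
    exact (norm_mul_le _ _).trans (by gcongr)

theorem ax_term_norm (T : E →L[ℂ] E) (n : ℕ) :
    ‖((Nat.factorial (2 * n + 1) : ℝ))⁻¹ • T ^ (2 * n)‖ ≤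
      ((Nat.factorial (2 * n + 1) : ℝ))⁻¹ * ‖T‖ ^ (2 * n) := by
  rw [norm_smul, Real.norm_of_nonneg (by positivity)]
  gcongr
  exact ax_pow_norm T _

theorem ax_real_summable (s : ℝ) (hs : 0 ≤ s) :
    Summable fun n : ℕ => ((Nat.factorial (2 * n + 1) : ℝ))⁻¹ * s ^ (2 * n) := by
  have h := (Real.summable_pow_div_factorial s).comp_injective
    (i := fun n : ℕ => 2 * n) (fun a b h => by simpa using h)
  refine Summable.of_nonneg_of_le (fun _ => by positivity) (fun n => ?_) h
  rw [mul_comm, ← div_eq_mul_inv]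
  simp only [Function.comp_apply]
  gcongr
  omega

theorem ax_summable [CompleteSpace E] (T : E →L[ℂ] E) :
    Summable fun n : ℕ => ((Nat.factorial (2 * n + 1) : ℝ))⁻¹ • T ^ (2 * n) :=
  Summable.of_norm_bounded (ax_real_summable ‖T‖ (norm_nonneg _)) (ax_term_norm T)

/-- The series of `sinh T / T`. -/
def axS (T : E →L[ℂ] E) : E →L[ℂ] E :=
  ∑' n : ℕ, ((Nat.factorial (2 * n + 1) : ℝ))⁻¹ • T ^ (2 * n)

theorem axS_norm (T : E →L[ℂ] E) (s : ℝ) (hs : 0 < s) (hT : ‖T‖ ≤ s) :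
    ‖axS T‖ ≤ Real.sinh s / s := by
  have h := (Real.hasSum_sinh s).div_const s
  refine tsum_of_norm_bounded h fun n => (ax_term_norm T n).trans ?_
  have : s ^ (2 * n + 1) / ((Nat.factorial (2 * n + 1) : ℝ)) / s =
      ((Nat.factorial (2 * n + 1) : ℝ))⁻¹ * s ^ (2 * n) := by
    field_simp
    ring
  rw [this]
  gcongr

theorem axS_hasSum [CompleteSpace E] (T : E →L[ℂ] E) (x : E) :
    HasSum (fun n : ℕ => ((Nat.factorial (2 * n + 1) : ℝ))⁻¹ • (T ^ (2 * n)) x) (axS T x) := by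
  have h : HasSum (fun n : ℕ => ((Nat.factorial (2 * n + 1) : ℝ))⁻¹ • T ^ (2 * n)) (axS T) :=
    (ax_summable T).hasSum
  have h2 := h.mapL (ContinuousLinearMap.apply ℂ E x)
  simpa only [ContinuousLinearMap.apply_apply, smul_apply] using h2

end series

section pos

variable {K : Type*} [NormedAddCommGroup K] [InnerProductSpace ℂ K] [CompleteSpace K]

theorem axS_one_le (T : K →L[ℂ] K) (hT : IsSelfAdjoint T) : 1 ≤ axS T := by
  have h := (ax_summable T).le_tsum 0 (fun n _ => by
    apply smul_nonneg (by positivity)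
    have : T ^ (2 * n) = star (T ^ n) * T ^ n := by
      rw [star_pow, hT.star_eq, two_mul, pow_add]
    rw [this]
    exact star_mul_self_nonneg _)
  simpa [axS] using h

theorem axS_isUnit (T : K →L[ℂ] K) (hT : IsSelfAdjoint T) : IsUnit (axS T) :=
  CStarAlgebra.isUnit_of_le 1 (axS_one_le T hT) (by simp)

theorem axS_lower (T : K →L[ℂ] K) (hT : IsSelfAdjoint T) (f : K) : ‖f‖ ≤ ‖axS T f‖ := by
  have h := (ContinuousLinearMap.le_def _ _).1 (axS_one_le T hT)
  have h1 := h.re_inner_nonneg_left f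
  rw [sub_apply, inner_sub_left, map_sub] at h1
  have h2 : RCLike.re (inner ℂ ((1 : K →L[ℂ] K) f) f : ℂ) = ‖f‖ * ‖f‖ :=
    inner_self_eq_norm_mul_norm (𝕜 := ℂ) f
  have h3 := re_inner_le_norm (𝕜 := ℂ) (axS T f) f
  rcases (norm_nonneg f).eq_or_lt with h0 | h0
  · rw [← h0]; positivity
  · exact le_of_mul_le_mul_right (by linarith) h0

end pos

theorem tauOp_eq (X : H →L[ℂ] H) : tauOp X = axS (axD X) := rfl

theorem tauOp_phi (e : HilbertBasis ι ℂ H) (X : H →L[ℂ] H) (f : lp (fun _ : ι => H) 2) :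
    axPhi e (axS (axT e X) f) = tauOp X (axPhi e f) := by
  rw [tauOp_eq]
  refine HasSum.unique ((axPhi e).hasSum (axS_hasSum (axT e X) f)) ?_
  convert! axS_hasSum (axD X) (axPhi e f) using 2 with n
  have := axPhi_T_pow e X (2 * n) f
  rw [← this]
  exact (axPhi e).map_smul_of_tower _ _

theorem axD_star (X : H →L[ℂ] H) (hX : IsSelfAdjoint X) (Y : H →L[ℂ] H) :
    axD X (star Y) = - star (axD X Y) := by
  rw [axD_apply, axD_apply, star_smul, star_sub, star_mul, star_mul, hX.star_eq, ← smul_neg, neg_sub]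
  simp

theorem axD_pow_star (X : H →L[ℂ] H) (hX : IsSelfAdjoint X) (n : ℕ) (Y : H →L[ℂ] H) :
    (axD X ^ (2 * n)) (star Y) = star ((axD X ^ (2 * n)) Y) := by
  induction n generalizing Y with
  | zero => rfl
  | succ n ih =>
    rw [mul_add, pow_add]
    simp only [ax_mul_apply]
    rw [← ih]
    congr 1
    simp only [mul_one, pow_two, ax_mul_apply]
    rw [axD_star X hX, map_neg, axD_star X hX, neg_neg]

theorem tauOp_star (X : H →L[ℂ] H) (hX : IsSelfAdjoint X) (Y : H →L[ℂ] H) :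
    tauOp X (star Y) = star (tauOp X Y) := by
  rw [tauOp_eq]
  refine HasSum.unique (axS_hasSum (axD X) (star Y)) ?_
  convert! (axS_hasSum (axD X) Y).star using 2 with n
  rw [axD_pow_star X hX]
  simp [star_smul]

/-- For `X ∈ S₂(H)`, `τ_X` is a bounded bijective linear operator of
`S₂(H)` with `‖τ_X Y‖₂ ≥ ‖Y‖₂`, and (for `X ≠ 0`) of operator norm at most
`sinh(2‖X‖₂)/‖X‖₂`. -/
theorem statement4 (e : HilbertBasis ι ℂ H) (X : H →L[ℂ] H) (hX : MemS2 e X) :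
    (∀ Y : H →L[ℂ] H, MemS2 e Y → MemS2 e (tauOp X Y)) ∧
    (∀ Y : H →L[ℂ] H, MemS2 e Y → hsNorm e Y ≤ hsNorm e (tauOp X Y)) ∧
    (∀ Z : H →L[ℂ] H, MemS2 e Z → ∃! Y : H →L[ℂ] H, MemS2 e Y ∧ tauOp X Y = Z) ∧
    (X ≠ 0 → ∀ Y : H →L[ℂ] H, MemS2 e Y →
      hsNorm e (tauOp X Y) ≤ (Real.sinh (2 * hsNorm e X) / hsNorm e X) * hsNorm e Y) := by
  have key : ∀ Y (hY : IsHS e Y), tauOp X Y = axPhi e (axS (axT e X) (toK e Y hY)) := fun Y hY => by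
    rw [tauOp_phi, axPhi_toK]
  have hT := axT_sa e X hX.1
  have mem : ∀ Y : H →L[ℂ] H, MemS2 e Y → MemS2 e (tauOp X Y) := fun Y hY => by
    refine ⟨?_, ?_⟩
    · rw [isSelfAdjoint_iff, ← tauOp_star X hX.1, hY.1.star_eq]
    · rw [key Y hY.2]
      exact axPhi_hs e _
  have low : ∀ Y : H →L[ℂ] H, IsHS e Y → hsNorm e Y ≤ hsNorm e (tauOp X Y) := fun Y hY => by
    rw [key Y hY, axPhi_hsNorm, ← toK_norm e Y hY]
    exact axS_lower _ hT _
  have inj : ∀ Y Y' : H →L[ℂ] H, IsHS e Y → IsHS e Y' → tauOp X Y = tauOp X Y' → Y = Y' := by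
    intro Y Y' hY hY' h
    rw [key Y hY, key Y' hY'] at h
    have h1 := axPhi_inj e h
    have h2 := axS_lower _ hT (toK e Y hY - toK e Y' hY')
    rw [map_sub, h1, sub_self, norm_zero, norm_le_zero_iff, sub_eq_zero] at h2
    rw [← axPhi_toK e Y hY, h2, axPhi_toK]
  refine ⟨mem, fun Y hY => low Y hY.2, fun Z hZ => ?_, fun hX0 Y hY => ?_⟩
  · obtain ⟨u, hu⟩ := axS_isUnit _ hT
    set y := (↑u⁻¹ : lp (fun _ : ι => H) 2 →L[ℂ] lp (fun _ : ι => H) 2) (toK e Z hZ.2) with hy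
    have h1 : axS (axT e X) y = toK e Z hZ.2 := by
      rw [hy, ← hu, ← ax_mul_apply, u.mul_inv]
      rfl
    have h2 : tauOp X (axPhi e y) = Z := by
      rw [← tauOp_phi, h1, axPhi_toK]
    have h3 : IsHS e (axPhi e y) := axPhi_hs e y
    refine ⟨axPhi e y, ⟨⟨?_, h3⟩, h2⟩, fun W hW => inj _ _ hW.1.2 h3 (hW.2.trans h2.symm)⟩
    rw [isSelfAdjoint_iff]
    apply inj _ _ (hs_star e h3) h3
    rw [tauOp_star X hX.1, h2, hZ.1.star_eq]
  · have hop := opNorm_le_hs e X hX.2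
    have hs : 0 < hsNorm e X := (norm_pos_iff.2 hX0).trans_le hop
    rw [key Y hY.2, axPhi_hsNorm, ← toK_norm e Y hY.2]
    refine (ContinuousLinearMap.le_opNorm _ _).trans ?_
    gcongr
    refine (axS_norm _ _ hs ((axT_norm e X).trans hop)).trans ?_
    gcongr
    rw [Real.sinh_le_sinh]
    linarith
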